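/- In a cylindrical growth diagram for SL₃ of shape a 3×k rectangle: if γ_{i,i+1} = ω₁ = (1,0,0), then the single row index in which γ_{i,j} and γ_{i+1,j} differ is weakly increasing in j, starting at 1 when j = i+1 and ending at 3 when j = i+n. (Formally: for each j the partitions γ_{i,j} and γ_{i+1,j} differ by one box in a single row r(j) ∈ {1,2,3}, r(i+1) = 1, r(i+n) = 3, and r is weakly increasing.) -/

import Mathlib

noncomputable section

/-- Sort a triple of integers into weakly decreasing order. -/
def sort3 (x : Fin 3 → ℤ) : Fin 3 → ℤ :=
  ![max (max (x 0) (x 1)) (x 2),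
    x 0 + x 1 + x 2 - max (max (x 0) (x 1)) (x 2) - min (min (x 0) (x 1)) (x 2),
    min (min (x 0) (x 1)) (x 2)]

/-- A cylindrical growth diagram for `SL₃` of shape the `3 × k` rectangle `(k,k,k)`, on
the (periodically extended) staircase `{(i,j) : i ≤ j ≤ i + n}`.  Each entry `γ i j` is a
partition with at most three parts; the entries vanish on the diagonal, equal the full
rectangle at `j = i + n`, neighboring entries differ by vertical strips, the local growth
rule `γ_{i+1,j+1} = sort(γ_{i+1,j} + γ_{i,j+1} - γ_{i,j})` holds on every unit square,
and the diagram is periodic: `γ_{i+n,j+n} = γ_{i,j}`. -/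
structure CylGrowthDiagram (n k : ℕ) where
  γ : ℤ → ℤ → Fin 3 → ℤ
  nonneg : ∀ i j : ℤ, i ≤ j → j ≤ i + n → ∀ r, 0 ≤ γ i j r
  antitone : ∀ i j : ℤ, i ≤ j → j ≤ i + n → γ i j 1 ≤ γ i j 0 ∧ γ i j 2 ≤ γ i j 1
  diag : ∀ i : ℤ, γ i i = fun _ => 0
  rect : ∀ i : ℤ, γ i (i + n) = fun _ => (k : ℤ)
  vstrip_col : ∀ i j : ℤ, i + 1 ≤ j → j ≤ i + n →
    ∀ r, γ (i + 1) j r ≤ γ i j r ∧ γ i j r ≤ γ (i + 1) j r + 1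
  vstrip_row : ∀ i j : ℤ, i ≤ j → j + 1 ≤ i + n →
    ∀ r, γ i j r ≤ γ i (j + 1) r ∧ γ i (j + 1) r ≤ γ i j r + 1
  locRule : ∀ i j : ℤ, i + 1 ≤ j → j + 1 ≤ i + n →
    γ (i + 1) (j + 1) = sort3 (fun r => γ (i + 1) j r + γ i (j + 1) r - γ i j r)
  periodic : ∀ i j : ℤ, γ (i + n) (j + n) = γ i j

/-- One step of the local rule: the row of the removed box weakly increases. -/
lemma dif_step (a b c e : Fin 3 → ℤ) (p : Fin 3)
    (hab : ∀ s, a s = b s + if s = p then 1 else 0)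
    (hc : c 1 ≤ c 0 ∧ c 2 ≤ c 1)
    (he : e = sort3 (fun s => b s + c s - a s)) :
    ∃ q : Fin 3, p ≤ q ∧ ∀ s, c s = e s + if s = q then 1 else 0 := by
  have h0 := hab 0
  have h1 := hab 1
  have h2 := hab 2
  have e0 := congrFun he 0
  have e1 := congrFun he 1
  have e2 := congrFun he 2
  obtain ⟨c1, c2⟩ := hc
  obtain ⟨x, hx⟩ : ∃ x : Fin 3 → ℤ, x = fun s => b s + c s - a s := ⟨_, rfl⟩
  have x0 : x 0 = c 0 - if (0 : Fin 3) = p then 1 else 0 := by rw [hx]; simp only; omega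
  have x1 : x 1 = c 1 - if (1 : Fin 3) = p then 1 else 0 := by rw [hx]; simp only; omega
  have x2 : x 2 = c 2 - if (2 : Fin 3) = p then 1 else 0 := by rw [hx]; simp only; omega
  rw [← hx] at e0 e1 e2
  simp only [sort3, Matrix.cons_val] at e0 e1 e2
  clear h0 h1 h2 hab he hx
  have fin : ∀ q : Fin 3, p ≤ q → (c 0 = e 0 + if (0 : Fin 3) = q then 1 else 0) →
      (c 1 = e 1 + if (1 : Fin 3) = q then 1 else 0) →
      (c 2 = e 2 + if (2 : Fin 3) = q then 1 else 0) →
      ∃ q : Fin 3, p ≤ q ∧ ∀ s, c s = e s + if s = q then 1 else 0 := by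
    intro q hq k0 k1 k2
    refine ⟨q, hq, fun s => ?_⟩
    fin_cases s
    · exact k0
    · exact k1
    · exact k2
  obtain ⟨M, hM⟩ : ∃ M, M = max (max (x 0) (x 1)) (x 2) := ⟨_, rfl⟩
  obtain ⟨m, hm⟩ : ∃ m, m = min (min (x 0) (x 1)) (x 2) := ⟨_, rfl⟩
  rw [← hM] at e0 e1
  rw [← hm] at e1 e2
  rcases c1.lt_or_eq with c1 | c1 <;> rcases c2.lt_or_eq with c2 | c2 <;> fin_cases p <;>
    simp at x0 x1 x2
  all_goals
    first
    | (have tM : M = c 0 := by omega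
       have tm : m = c 2 := by omega
       refine fin 1 (by decide) ?_ ?_ ?_ <;> simp <;> omega)
    | (have tM : M = c 0 := by omega
       have tm : m = c 2 - 1 := by omega
       refine fin 2 (by decide) ?_ ?_ ?_ <;> simp <;> omega)
    | (have tM : M = c 0 - 1 := by omega
       have tm : m = c 2 := by omega
       refine fin 0 (by decide) ?_ ?_ ?_ <;> simp <;> omega)

lemma dif_unique (a b : Fin 3 → ℤ) (p q : Fin 3)
    (hp : ∀ s, a s = b s + if s = p then 1 else 0)
    (hq : ∀ s, a s = b s + if s = q then 1 else 0) : p = q := by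
  have h1 := hp p
  have h2 := hq p
  by_contra hne
  simp [hne] at h1 h2
  omega

/-- If `γ_{i,i+1} = ω₁ = (1,0,0)`, then for each `j` with `i+1 ≤ j ≤ i+n` the partitions
`γ_{i,j}` and `γ_{i+1,j}` differ by one box in a single row `r j`; `r (i+1) = 1`,
`r (i+n) = 3` (rows indexed `0,1,2` here), and `r` is weakly increasing in `j`. -/
theorem dif_singleton_monotone {n k : ℕ} (D : CylGrowthDiagram n k) (i : ℤ)
    (h : D.γ i (i + 1) = ![1, 0, 0]) :
    ∃ r : ℤ → Fin 3,
      (∀ j : ℤ, i + 1 ≤ j → j ≤ i + n →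
        ∀ s, D.γ i j s = D.γ (i + 1) j s + if s = r j then 1 else 0) ∧
      r (i + 1) = 0 ∧ r (i + n) = 2 ∧
      (∀ j j' : ℤ, i + 1 ≤ j → j ≤ j' → j' ≤ i + n → r j ≤ r j') := by
  classical
  rcases Nat.eq_zero_or_pos n with hn | hn
  · subst hn
    refine ⟨fun j => if j = i then 2 else 0, ?_, by simp, by simp, ?_⟩
    · intro j h1 h2
      simp at h2
      omega
    · intro j j' h1 h2 h3
      simp at h3
      omega
  have hex : ∀ j : ℤ, i + 1 ≤ j → j ≤ i + n →
      ∃ p : Fin 3, ∀ s, D.γ i j s = D.γ (i + 1) j s + if s = p then 1 else 0 := by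
    intro j hj
    induction j, hj using Int.leInduction with
    | base =>
      intro _
      refine ⟨0, fun s => ?_⟩
      rw [h, D.diag]
      fin_cases s <;> simp
    | succ j hj ih =>
      intro hj2
      obtain ⟨p, hp⟩ := ih (by omega)
      obtain ⟨q, _, hq⟩ := dif_step _ _ _ _ p hp
        (D.antitone i (j + 1) (by omega) hj2) (D.locRule i j hj hj2)
      exact ⟨q, hq⟩
  have hex' : ∀ j : ℤ, ∃ p : Fin 3, i + 1 ≤ j → j ≤ i + n →
      ∀ s, D.γ i j s = D.γ (i + 1) j s + if s = p then 1 else 0 := by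
    intro j
    by_cases h1 : i + 1 ≤ j
    · by_cases h2 : j ≤ i + n
      · obtain ⟨p, hp⟩ := hex j h1 h2
        exact ⟨p, fun _ _ => hp⟩
      · exact ⟨0, fun _ h => absurd h h2⟩
    · exact ⟨0, fun h => absurd h h1⟩
  choose r hr using hex'
  refine ⟨r, hr, ?_, ?_, ?_⟩
  · refine dif_unique _ _ _ _ (hr (i + 1) le_rfl (by omega)) (fun s => ?_)
    rw [h, D.diag]
    fin_cases s <;> simp
  · have h1 := hr (i + n) (by omega) le_rfl
    have h2 := D.antitone (i + 1) (i + n) (by omega) (by omega)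
    rw [D.rect] at h1
    have a0 := h1 0
    have a1 := h1 1
    have a2 := h1 2
    generalize r (i + n) = p at *
    fin_cases p <;> simp at a0 a1 a2 ⊢ <;> omega
  · intro j j' hj hjj
    induction j', hjj using Int.leInduction with
    | base => intro _; exact le_rfl
    | succ m hm ih =>
      intro hm2
      refine (ih (by omega)).trans ?_
      obtain ⟨q, hle, hq⟩ := dif_step _ _ _ _ (r m) (hr m (by omega) (by omega))
        (D.antitone i (m + 1) (by omega) hm2) (D.locRule i m (by omega) hm2)
      rw [dif_unique _ _ _ _ (hr (m + 1) (by omega) hm2) hq]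
      exact hle
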